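/- arXiv:2104.10188 — 5 statements merged into one kernel-verified Lean document; each statement's English description precedes it below -/
import Mathlib

section
/- Let T̲ : ℝ^𝒳 → ℝ^𝒳 be a coherent map that satisfies the reachability condition (R1). Then the hitting-time system h = 𝟙_{Aᶜ} + 𝟙_{Aᶜ}·(T̲h) has a unique solution h in ℝ^𝒳, and this solution is non-negative (h(x) ≥ 0 for all x ∈ 𝒳). -/
open Function Set

/-- A map `T : ℝ^𝒳 → ℝ^𝒳` is *coherent* if it is non-negatively homogeneous (C1),
super-additive (C2), and dominates the pointwise minimum (C3). -/
def Coherent {X : Type*} [Fintype X] [Nonempty X] (T : (X → ℝ) → (X → ℝ)) : Prop :=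
  (∀ (α : ℝ), 0 ≤ α → ∀ f, T (α • f) = α • T f) ∧
  (∀ f g, T f + T g ≤ T (f + g)) ∧
  (∀ (f : X → ℝ) (x : X), (⨅ y, f y) ≤ T f x)

/-- The reachability condition (R1). -/
def Reach {X : Type*} (A : Set X) (T : (X → ℝ) → (X → ℝ)) : Prop :=
  ∀ x ∈ Aᶜ, ∃ n : ℕ, 0 < n ∧ 0 < T^[n] (A.indicator 1) x

namespace Coherent

variable {X : Type*} [Fintype X] [Nonempty X] {T : (X → ℝ) → (X → ℝ)}

theorem le_of_forall_le (hT : Coherent T) {f : X → ℝ} {c : ℝ} (hc : ∀ y, c ≤ f y) (x : X) :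
    c ≤ T f x :=
  (le_ciInf hc).trans (hT.2.2 f x)

theorem mono (hT : Coherent T) : Monotone T := by
  intro f g hfg x
  have h1 := hT.2.1 f (g - f) x
  have h2 : 0 ≤ T (g - f) x := hT.le_of_forall_le (fun y => sub_nonneg.2 (hfg y)) x
  rw [add_sub_cancel, Pi.add_apply] at h1
  linarith

theorem map_one_le (hT : Coherent T) : T 1 ≤ 1 := by
  intro x
  have h1 := hT.2.1 1 (-1) x
  have h2 : -1 ≤ T (-1) x := hT.le_of_forall_le (fun y => by simp) x
  have h3 : T 0 x = 0 := by simpa using congrFun (hT.1 0 le_rfl 0) x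
  rw [add_neg_cancel, h3, Pi.add_apply] at h1
  rw [Pi.one_apply]
  linarith

theorem map_le_map_add (hT : Coherent T) {u v p : X → ℝ} {c : ℝ} (hc : 0 ≤ c)
    (h : ∀ y, u y ≤ v y + c * (1 - p y)) (x : X) : T u x ≤ T v x + c * (1 - T p x) := by
  have h1 : T (u + c • p + fun _ => -c) x ≤ T v x := by
    refine hT.mono (fun y => ?_) x
    simp only [Pi.add_apply, Pi.smul_apply, smul_eq_mul]
    linarith [h y]
  have h2 := hT.2.1 (u + c • p) (fun _ => -c) x
  have h3 := hT.2.1 u (c • p) x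
  have h4 : -c ≤ T (fun _ => -c) x := hT.le_of_forall_le (fun y => le_rfl) x
  rw [hT.1 c hc] at h3
  simp only [Pi.add_apply, Pi.smul_apply, smul_eq_mul] at h2 h3
  linarith

end Coherent

/-- The operator whose fixed points are the solutions of the hitting-time system. -/
noncomputable def hittingTimeMap {X : Type*} (A : Set X) (T : (X → ℝ) → (X → ℝ)) (f : X → ℝ) :
    X → ℝ :=
  (Aᶜ : Set X).indicator 1 + (Aᶜ : Set X).indicator 1 * T f

/-- The one-step operator for lower probabilities of hitting `A` in bounded time. -/
noncomputable def hittingProbMap {X : Type*} (A : Set X) (T : (X → ℝ) → (X → ℝ)) (f : X → ℝ) :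
    X → ℝ :=
  A.indicator 1 + (Aᶜ : Set X).indicator 1 * T f

section

variable {X : Type*} {A : Set X} {T : (X → ℝ) → (X → ℝ)} {x : X}

theorem hittingTimeMap_of_mem (hx : x ∈ A) (f : X → ℝ) : hittingTimeMap A T f x = 0 := by
  simp [hittingTimeMap, hx]

theorem hittingTimeMap_of_notMem (hx : x ∉ A) (f : X → ℝ) :
    hittingTimeMap A T f x = 1 + T f x := by
  simp [hittingTimeMap, hx]

theorem hittingProbMap_of_mem (hx : x ∈ A) (f : X → ℝ) : hittingProbMap A T f x = 1 := by
  simp [hittingProbMap, hx]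

theorem hittingProbMap_of_notMem (hx : x ∉ A) (f : X → ℝ) :
    hittingProbMap A T f x = T f x := by
  simp [hittingProbMap, hx]

variable [Fintype X] [Nonempty X]

theorem hittingProbMap_mono (hT : Coherent T) : Monotone (hittingProbMap A T) := by
  intro f g hfg x
  by_cases hx : x ∈ A
  · simp [hittingProbMap_of_mem hx]
  · simpa [hittingProbMap_of_notMem hx] using hT.mono hfg x

theorem iterate_hittingProbMap_monotone (hT : Coherent T) :
    Monotone fun n => (hittingProbMap A T)^[n] 0 := by
  refine (hittingProbMap_mono hT).monotone_iterate_of_le_map fun x => ?_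
  by_cases hx : x ∈ A
  · simp [hittingProbMap_of_mem hx]
  · simpa [hittingProbMap_of_notMem hx] using
      hT.le_of_forall_le (f := 0) (c := 0) (fun _ => le_rfl) x

theorem iterate_hittingProbMap_le_one (hT : Coherent T) (n : ℕ) :
    (hittingProbMap A T)^[n] 0 ≤ 1 := by
  induction n with
  | zero => exact zero_le_one
  | succ n ih =>
    intro x
    rw [iterate_succ_apply']
    by_cases hx : x ∈ A
    · simp [hittingProbMap_of_mem hx]
    · rw [hittingProbMap_of_notMem hx]
      exact (hT.mono ih x).trans (hT.map_one_le x)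

theorem iterate_indicator_le_iterate_hittingProbMap (hT : Coherent T) (n : ℕ) :
    T^[n] (A.indicator 1) ≤ (hittingProbMap A T)^[n + 1] 0 := by
  induction n with
  | zero =>
    intro x
    by_cases hx : x ∈ A
    · simp [hittingProbMap_of_mem hx, hx]
    · simpa [hittingProbMap_of_notMem hx, hx] using
        hT.le_of_forall_le (f := 0) (c := 0) (fun _ => le_rfl) x
  | succ n ih =>
    intro x
    rw [iterate_succ_apply', iterate_succ_apply' _ (n + 1)]
    refine (hT.mono ih x).trans ?_
    by_cases hx : x ∈ A
    · rw [hittingProbMap_of_mem hx]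
      exact (hT.mono (iterate_hittingProbMap_le_one hT _) x).trans (hT.map_one_le x)
    · rw [hittingProbMap_of_notMem hx]

theorem exists_iterate_hittingProbMap_pos (hT : Coherent T) (hR : Reach A T) :
    ∃ N, ∀ x, 0 < (hittingProbMap A T)^[N] 0 x := by
  have h : ∀ x, ∃ n, 0 < (hittingProbMap A T)^[n] 0 x := by
    intro x
    by_cases hx : x ∈ A
    · exact ⟨1, by simp [hittingProbMap_of_mem hx]⟩
    · obtain ⟨n, -, hn⟩ := hR x hx
      exact ⟨n + 1, hn.trans_le (iterate_indicator_le_iterate_hittingProbMap hT n x)⟩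
  choose n hn using h
  exact ⟨Finset.univ.sup n, fun x => (hn x).trans_le
    (iterate_hittingProbMap_monotone hT (Finset.le_sup (Finset.mem_univ x)) x)⟩

theorem iterate_hittingTimeMap_le (hT : Coherent T) {f g : X → ℝ} {c : ℝ} (hc : 0 ≤ c)
    (h : ∀ y, f y ≤ g y + c) (n : ℕ) (x : X) :
    (hittingTimeMap A T)^[n] f x ≤
      (hittingTimeMap A T)^[n] g x + c * (1 - (hittingProbMap A T)^[n] 0 x) := by
  induction n generalizing x with
  | zero => simpa using h x
  | succ n ih =>
    simp only [iterate_succ_apply']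
    by_cases hx : x ∈ A
    · simp [hittingProbMap_of_mem hx, hittingTimeMap_of_mem hx]
    · simp only [hittingProbMap_of_notMem hx, hittingTimeMap_of_notMem hx]
      linarith [hT.map_le_map_add hc ih x]

theorem exists_contractingWith_iterate_hittingTimeMap (hT : Coherent T) (hR : Reach A T) :
    ∃ N K, ContractingWith K (hittingTimeMap A T)^[N] := by
  obtain ⟨N, hN⟩ := exists_iterate_hittingProbMap_pos hT hR
  obtain ⟨x₀, hx₀⟩ := Finite.exists_min ((hittingProbMap A T)^[N] 0)
  have hpos := hN x₀
  have hle : (hittingProbMap A T)^[N] 0 x₀ ≤ 1 := iterate_hittingProbMap_le_one hT N x₀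
  generalize (hittingProbMap A T)^[N] 0 x₀ = δ at hx₀ hpos hle
  refine ⟨N, ⟨1 - δ, sub_nonneg.2 hle⟩, NNReal.coe_lt_coe.1 (sub_lt_self 1 hpos),
    LipschitzWith.of_dist_le_mul fun f g => ?_⟩
  have key : ∀ (u v : X → ℝ) (x : X), (hittingTimeMap A T)^[N] u x ≤
      (hittingTimeMap A T)^[N] v x + (1 - δ) * dist u v := by
    intro u v x
    have h := iterate_hittingTimeMap_le (A := A) (f := u) (g := v) (c := dist u v) hT dist_nonneg
      (fun y => by
        have := (le_abs_self _).trans ((Real.dist_eq _ _).symm.trans_le (dist_le_pi_dist u v y))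
        linarith) N x
    nlinarith [hx₀ x, dist_nonneg (x := u) (y := v)]
  refine (dist_pi_le_iff (mul_nonneg (sub_nonneg.2 hle) dist_nonneg)).2 fun x => ?_
  rw [Real.dist_eq, abs_le]
  change -((1 - δ) * dist f g) ≤ _ ∧ _ ≤ (1 - δ) * dist f g
  have h1 := key f g x
  have h2 := key g f x
  rw [dist_comm g f] at h2
  constructor <;> linarith

theorem nonneg_of_eq_hittingTimeMap (hT : Coherent T) {h : X → ℝ}
    (hh : h = hittingTimeMap A T h) (x : X) : 0 ≤ h x := by
  obtain ⟨x₀, hx₀⟩ := Finite.exists_min h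
  refine le_trans ?_ (hx₀ x)
  by_cases hx : x₀ ∈ A
  · rw [hh, hittingTimeMap_of_mem hx]
  · have h1 := congrFun hh x₀
    rw [hittingTimeMap_of_notMem hx] at h1
    linarith [hT.le_of_forall_le hx₀ x₀]

end

theorem stmt0 {X : Type*} [Fintype X] [Nonempty X] (A : Set X)
    (hA : A.Nonempty) (hAc : (Aᶜ : Set X).Nonempty)
    (T : (X → ℝ) → (X → ℝ)) (hT : Coherent T) (hR : Reach A T) :
    ∃ h : X → ℝ, (h = (Aᶜ : Set X).indicator 1 + (Aᶜ : Set X).indicator 1 * T h) ∧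
      (∀ x, 0 ≤ h x) ∧
      (∀ g : X → ℝ, g = (Aᶜ : Set X).indicator 1 + (Aᶜ : Set X).indicator 1 * T g → g = h) := by
  obtain ⟨N, K, hK⟩ := exists_contractingWith_iterate_hittingTimeMap hT hR
  have hfix : IsFixedPt (hittingTimeMap A T) (hK.fixedPoint _) := hK.isFixedPt_fixedPoint_iterate
  refine ⟨hK.fixedPoint _, hfix.symm, nonneg_of_eq_hittingTimeMap hT hfix.symm, fun g hg => ?_⟩
  have hg' : IsFixedPt (hittingTimeMap A T) g := hg.symm
  exact hK.fixedPoint_unique (hg'.iterate N)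
end

section
/- Let T : ℝ^𝒳 → ℝ^𝒳 be a linear coherent map that satisfies the reachability condition (R1). Then there is some x ∈ Aᶜ such that [T𝟙_A](x) > 0. -/
open Function Set

/-- A linear coherent map that sends the indicator of `A` to a function that is nonpositive off `A`
preserves nonpositivity off `A`. -/
theorem Coherent.apply_nonpos_of_nonpos_off {X : Type*} [Fintype X] [Nonempty X] {A : Set X}
    {T : (X → ℝ) → (X → ℝ)} (hlin : IsLinearMap ℝ T) (hT : Coherent T)
    (hA : ∀ x ∈ Aᶜ, T (A.indicator 1) x ≤ 0) {f : X → ℝ} (hf : ∀ x ∈ Aᶜ, f x ≤ 0) :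
    ∀ x ∈ Aᶜ, T f x ≤ 0 := by
  intro x hx
  set c : ℝ := ∑ y, |f y|
  have hc : 0 ≤ c := Finset.sum_nonneg fun y _ => abs_nonneg (f y)
  have hfc (y : X) : f y ≤ c :=
    (le_abs_self _).trans
      (Finset.single_le_sum (fun z _ => abs_nonneg (f z)) (Finset.mem_univ y))
  have hnonneg (y : X) : 0 ≤ (c • A.indicator 1 - f : X → ℝ) y := by
    by_cases hy : y ∈ A
    · simpa [hy] using hfc y
    · simpa [hy] using hf y hy
  have hTnonneg : 0 ≤ T (c • A.indicator 1 - f) x :=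
    (le_ciInf hnonneg).trans (hT.2.2 _ x)
  rw [hlin.map_sub, hlin.map_smul, Pi.sub_apply, Pi.smul_apply, smul_eq_mul] at hTnonneg
  linarith [mul_nonpos_of_nonneg_of_nonpos hc (hA x hx)]

theorem stmt7 {X : Type*} [Fintype X] [Nonempty X] (A : Set X)
    (hA : A.Nonempty) (hAc : (Aᶜ : Set X).Nonempty)
    (T : (X → ℝ) → (X → ℝ)) (hlin : IsLinearMap ℝ T) (hT : Coherent T)
    (hR : Reach A T) :
    ∃ x ∈ Aᶜ, 0 < T (A.indicator 1) x := by
  by_contra! h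
  have hiter (n : ℕ) : ∀ x ∈ Aᶜ, T^[n] (A.indicator 1) x ≤ 0 := by
    induction n with
    | zero => exact fun x hx => (indicator_of_notMem hx _).le
    | succ n ih =>
      rw [iterate_succ_apply']
      exact hT.apply_nonpos_of_nonpos_off hlin h ih
  obtain ⟨x, hx⟩ := hAc
  obtain ⟨n, -, hn⟩ := hR x hx
  exact (hiter n x hx).not_gt hn
end

section
/- Let T : ℝ^𝒳 → ℝ^𝒳 be a linear coherent map that satisfies the reachability condition (R1). Fix any x ∈ Aᶜ and any integer n > 1, and suppose that [Tⁿ𝟙_A](x) > 0 while [Tᵐ𝟙_A](x) = 0 for all positive integers m < n. Then there is some y ∈ Aᶜ such that [T𝟙_{{y}}](x) > 0 and [T^{n−1}𝟙_A](y) > 0. -/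
open Function Set

theorem Coherent.apply_nonneg {X : Type*} [Fintype X] [Nonempty X]
    {T : (X → ℝ) → (X → ℝ)} (hT : Coherent T) {f : X → ℝ} (hf : 0 ≤ f) (x : X) :
    0 ≤ T f x :=
  (le_ciInf hf).trans (hT.2.2 f x)

theorem Coherent.monotone {X : Type*} [Fintype X] [Nonempty X]
    {T : (X → ℝ) → (X → ℝ)} (hT : Coherent T) (hlin : IsLinearMap ℝ T) : Monotone T := by
  intro f g hfg x
  have h := hT.apply_nonneg (sub_nonneg.2 hfg) x
  rw [hlin.map_sub] at h
  exact sub_nonneg.1 h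

theorem IsLinearMap.apply_eq_sum_indicator {X : Type*} [Fintype X]
    {T : (X → ℝ) → (X → ℝ)} (hlin : IsLinearMap ℝ T) (f : X → ℝ) (x : X) :
    T f x = ∑ y, f y * T (({y} : Set X).indicator 1) x := by
  classical
  have hf : f = ∑ y, f y • ({y} : Set X).indicator (1 : X → ℝ) := by
    ext z
    simp [Finset.sum_apply, Pi.single_apply]
  have h := congrArg (hlin.mk' T) hf
  rw [map_sum] at h
  simpa [Finset.sum_apply, hlin.map_smul] using congrFun h x

/-- If a linear coherent map sends `f` to something positive at `x`, then some state `y` that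
is reachable from `x` in one step satisfies `0 < f y`. -/
theorem Coherent.exists_pos_of_apply_pos {X : Type*} [Fintype X] [Nonempty X]
    {T : (X → ℝ) → (X → ℝ)} (hT : Coherent T) (hlin : IsLinearMap ℝ T) {f : X → ℝ} {x : X}
    (h : 0 < T f x) : ∃ y, 0 < T (({y} : Set X).indicator 1) x ∧ 0 < f y := by
  rw [hlin.apply_eq_sum_indicator] at h
  obtain ⟨y, -, hy⟩ := Finset.exists_lt_of_sum_lt (by simpa using h :
    ∑ _y : X, (0 : ℝ) < ∑ y, f y * T (({y} : Set X).indicator 1) x)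
  have hTy : 0 ≤ T (({y} : Set X).indicator 1) x :=
    hT.apply_nonneg (indicator_nonneg fun _ _ => zero_le_one) x
  have hfy : 0 < f y := pos_of_mul_pos_left hy hTy
  exact ⟨y, pos_of_mul_pos_right hy hfy.le, hfy⟩

theorem stmt8 {X : Type*} [Fintype X] [Nonempty X] (A : Set X)
    (hA : A.Nonempty) (hAc : (Aᶜ : Set X).Nonempty)
    (T : (X → ℝ) → (X → ℝ)) (hlin : IsLinearMap ℝ T) (hT : Coherent T)
    (hR : Reach A T)
    (x : X) (hx : x ∈ Aᶜ) (n : ℕ) (hn : 1 < n)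
    (hpos : 0 < T^[n] (A.indicator 1) x)
    (hzero : ∀ m : ℕ, 0 < m → m < n → T^[m] (A.indicator 1) x = 0) :
    ∃ y ∈ Aᶜ, 0 < T (({y} : Set X).indicator 1) x ∧ 0 < T^[n-1] (A.indicator 1) y := by
  have hx1 : T (A.indicator 1) x = 0 := hzero 1 one_pos hn
  obtain ⟨k, rfl⟩ : ∃ k, n = k + 1 := ⟨n - 1, by omega⟩
  rw [iterate_succ_apply'] at hpos
  rw [Nat.add_sub_cancel]
  obtain ⟨y, hTy, hy⟩ := hT.exists_pos_of_apply_pos hlin hpos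
  refine ⟨y, fun hyA => ?_, hTy, hy⟩
  have hle : T (({y} : Set X).indicator 1) x ≤ T (A.indicator 1) x :=
    hT.monotone hlin (indicator_le_indicator_of_subset (singleton_subset_iff.2 hyA)
      fun _ => zero_le_one) x
  linarith
end

section
/- Let T̲ : ℝ^𝒳 → ℝ^𝒳 be a coherent map and let 𝒯 be the set of all linear coherent maps T : ℝ^𝒳 → ℝ^𝒳 with T̲f ≤ Tf for all f ∈ ℝ^𝒳. Then 𝒯 is nonempty, closed, and convex (as a subset of the space of maps from ℝ^𝒳 to ℝ^𝒳 with the operator norm), 𝒯 has separately specified rows, and for every f ∈ ℝ^𝒳 there is some T ∈ 𝒯 with T̲f = Tf; consequently T̲f = min_{T∈𝒯} Tf for all f ∈ ℝ^𝒳. -/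
open Function Set

/-- The dual representation of `Tl`: the set of all linear coherent maps that dominate `Tl`. -/
def DualRep {X : Type*} [Fintype X] [Nonempty X] (Tl : (X → ℝ) → (X → ℝ)) :
    Set ((X → ℝ) → (X → ℝ)) :=
  {T | IsLinearMap ℝ T ∧ Coherent T ∧ ∀ f, Tl f ≤ T f}

/-- A superlinear functional is dominated by a linear functional that agrees with it at a
prescribed point. -/
theorem exists_linearMap_ge_of_superlinear {E : Type*} [AddCommGroup E] [Module ℝ E]
    (q : E → ℝ) (hsmul : ∀ a : ℝ, 0 ≤ a → ∀ v, q (a • v) = a * q v)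
    (hadd : ∀ v w, q v + q w ≤ q (v + w)) (v₀ : E) :
    ∃ φ : E →ₗ[ℝ] ℝ, φ v₀ = q v₀ ∧ ∀ v, q v ≤ φ v := by
  have hzero : q 0 = 0 := by simpa using hsmul 0 le_rfl 0
  have hneg : ∀ v, q v ≤ -q (-v) := fun v => by
    have := hadd v (-v)
    rw [add_neg_cancel, hzero] at this
    linarith
  have H : ∀ c : ℝ, c • v₀ = 0 → c • q v₀ = 0 := by
    intro c hc
    rcases smul_eq_zero.1 hc with h | h <;> simp [h, hzero]
  obtain ⟨φ, hφ, hle⟩ := exists_extension_of_le_sublinear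
    (LinearPMap.mkSpanSingleton' (σ := RingHom.id ℝ) v₀ (q v₀) H) (fun v => -q (-v))
    (fun c hc v => by simp [← smul_neg, hsmul c hc.le])
    (fun v w => by
      have := hadd (-v) (-w)
      rw [neg_add]
      linarith)
    (by
      rintro ⟨v, hv⟩
      obtain ⟨c, rfl⟩ := Submodule.mem_span_singleton.1 hv
      rw [LinearPMap.mkSpanSingleton'_apply, smul_eq_mul]
      change c * q v₀ ≤ -q (-(c • v₀))
      rcases le_total 0 c with hc | hc
      · rw [← smul_neg, hsmul c hc]
        nlinarith [hneg v₀]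
      · rw [← neg_smul, hsmul (-c) (neg_nonneg.2 hc)]
        linarith)
  refine ⟨φ, ?_, fun v => ?_⟩
  · have hmem : v₀ ∈ (LinearPMap.mkSpanSingleton' (σ := RingHom.id ℝ) v₀ (q v₀) H).domain :=
      Submodule.mem_span_singleton_self v₀
    rw [hφ ⟨v₀, hmem⟩, LinearPMap.mkSpanSingleton'_apply_self]
  · have := hle (-v)
    simp only [neg_neg, map_neg] at this
    linarith

section DualRep

variable {X : Type*} [Fintype X] [Nonempty X] {Tl : (X → ℝ) → (X → ℝ)}

theorem mem_dualRep_iff (hTl : Coherent Tl) {T : (X → ℝ) → (X → ℝ)} :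
    T ∈ DualRep Tl ↔ ∀ x : X,
      (∀ f g, T (f + g) x = T f x + T g x) ∧ (∀ (c : ℝ) f, T (c • f) x = c * T f x) ∧
        ∀ f, Tl f x ≤ T f x := by
  constructor
  · rintro ⟨hlin, -, hle⟩ x
    exact ⟨fun f g => congrFun (hlin.map_add f g) x, fun c f => congrFun (hlin.map_smul c f) x,
      fun f => hle f x⟩
  · intro h
    have hadd : ∀ f g, T (f + g) = T f + T g := fun f g => funext fun x => (h x).1 f g
    have hsmul : ∀ (c : ℝ) f, T (c • f) = c • T f := fun c f => funext fun x => (h x).2.1 c f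
    exact ⟨⟨hadd, hsmul⟩, ⟨fun c _ f => hsmul c f, fun f g => (hadd f g).ge,
      fun f x => (hTl.2.2 f x).trans ((h x).2.2 f)⟩, fun f x => (h x).2.2 f⟩

theorem exists_mem_dualRep_eq (hTl : Coherent Tl) (f : X → ℝ) : ∃ T ∈ DualRep Tl, Tl f = T f := by
  choose φ hφ hle using fun x : X => exists_linearMap_ge_of_superlinear (fun g => Tl g x)
    (fun c hc g => congrFun (hTl.1 c hc g) x) (fun g h => hTl.2.1 g h x) f
  refine ⟨fun g x => φ x g, (mem_dualRep_iff hTl).2 fun x => ?_, funext fun x => (hφ x).symm⟩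
  exact ⟨map_add (φ x), fun c g => by simp, hle x⟩

theorem isClosed_dualRep (hTl : Coherent Tl) : IsClosed (DualRep Tl) := by
  have : DualRep Tl = {T | ∀ x : X,
      (∀ f g, T (f + g) x = T f x + T g x) ∧ (∀ (c : ℝ) f, T (c • f) x = c * T f x) ∧
        ∀ f, Tl f x ≤ T f x} := Set.ext fun T => mem_dualRep_iff hTl
  rw [this]
  simp only [ofPred_forall, ofPred_and]
  refine isClosed_iInter fun x => ((isClosed_iInter fun f => isClosed_iInter fun g => ?_).inter
    ((isClosed_iInter fun c => isClosed_iInter fun f => ?_).inter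
      (isClosed_iInter fun f => ?_)))
  · exact isClosed_eq (by fun_prop) (by fun_prop)
  · exact isClosed_eq (by fun_prop) (by fun_prop)
  · exact isClosed_le (by fun_prop) (by fun_prop)

theorem convex_dualRep (hTl : Coherent Tl) : Convex ℝ (DualRep Tl) := by
  intro S hS T hT a b ha hb hab
  rw [mem_dualRep_iff hTl] at *
  intro x
  obtain ⟨hSadd, hSsmul, hSle⟩ := hS x
  obtain ⟨hTadd, hTsmul, hTle⟩ := hT x
  simp only [Pi.add_apply, Pi.smul_apply, smul_eq_mul]
  refine ⟨fun f g => ?_, fun c f => ?_, fun f => ?_⟩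
  · rw [hSadd, hTadd]; ring
  · rw [hSsmul, hTsmul]; ring
  · calc Tl f x = a * Tl f x + b * Tl f x := by rw [← add_mul, hab, one_mul]
      _ ≤ a * S f x + b * T f x := by gcongr <;> simp only [hSle, hTle]

theorem dualRep_eq_setOf_rows (hTl : Coherent Tl) :
    DualRep Tl = {T | ∀ x : X, ∃ S ∈ DualRep Tl, ∀ f : X → ℝ, T f x = S f x} := by
  ext T
  refine ⟨fun hT x => ⟨T, hT, fun f => rfl⟩, fun hT => (mem_dualRep_iff hTl).2 fun x => ?_⟩
  obtain ⟨S, hS, h⟩ := hT x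
  simpa only [h] using (mem_dualRep_iff hTl).1 hS x

end DualRep

theorem stmt15 {X : Type*} [Fintype X] [Nonempty X]
    (Tl : (X → ℝ) → (X → ℝ)) (hTl : Coherent Tl) :
    (DualRep Tl).Nonempty ∧
    IsClosed (DualRep Tl) ∧
    Convex ℝ (DualRep Tl) ∧
    (DualRep Tl = {T | ∀ x : X, ∃ S ∈ DualRep Tl, ∀ f : X → ℝ, T f x = S f x}) ∧
    (∀ f : X → ℝ, ∃ T ∈ DualRep Tl, Tl f = T f) ∧
    (∀ (f : X → ℝ) (x : X), IsLeast {r : ℝ | ∃ T ∈ DualRep Tl, r = T f x} (Tl f x)) := by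
  refine ⟨?_, isClosed_dualRep hTl, convex_dualRep hTl, dualRep_eq_setOf_rows hTl,
    exists_mem_dualRep_eq hTl, fun f x => ⟨?_, ?_⟩⟩
  · obtain ⟨T, hT, -⟩ := exists_mem_dualRep_eq hTl 0
    exact ⟨T, hT⟩
  · obtain ⟨T, hT, h⟩ := exists_mem_dualRep_eq hTl f
    exact ⟨T, hT, congrFun h x⟩
  · rintro r ⟨T, hT, rfl⟩
    exact hT.2.2 f x
end

section
/- Let T̲ : ℝ^𝒳 → ℝ^𝒳 be a coherent map satisfying the reachability condition (R1), with dual representation 𝒯, and suppose that 𝒯 has a finite number m ≥ 1 of extreme points. Let {hₙ} be a sequence in ℝ^𝒳 constructed as follows: for each n ≥ 1, Tₙ is an extreme point of 𝒯, hₙ is the unique solution in ℝ^𝒳 of hₙ = 𝟙_{Aᶜ} + 𝟙_{Aᶜ}·(Tₙhₙ), and T̲hₙ = T_{n+1}hₙ. Then there is some n ≤ m such that hₖ = h_* for all k ≥ n, where h_* := lim_{ℓ→∞} h_ℓ. -/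
open Function Set Filter Topology

/-- A nonnegative function has a nonnegative image under a coherent map. -/
theorem Coherent.map_nonneg {X : Type*} [Fintype X] [Nonempty X] {T : (X → ℝ) → (X → ℝ)}
    (hT : Coherent T) {f : X → ℝ} (hf : 0 ≤ f) : 0 ≤ T f := fun x =>
  (le_ciInf fun y => hf y).trans (hT.2.2 f x)

theorem Coherent.mono_s19 {X : Type*} [Fintype X] [Nonempty X] {T : (X → ℝ) → (X → ℝ)}
    (hT : Coherent T) {f g : X → ℝ} (hfg : f ≤ g) : T f ≤ T g := by
  have h₁ := hT.2.1 f (g - f)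
  rw [add_sub_cancel] at h₁
  exact (le_add_of_nonneg_right (hT.map_nonneg (sub_nonneg.2 hfg))).trans h₁

/-- A function that is nonpositive on the zero set of `u ≥ 0` is bounded by a multiple of `u`. -/
theorem exists_le_smul_of_nonpos_on_zeros {X : Type*} [Fintype X] {f u : X → ℝ} (hu : 0 ≤ u)
    (hf : ∀ x, u x = 0 → f x ≤ 0) : ∃ K : ℝ, 0 ≤ K ∧ f ≤ K • u := by
  have hnn : ∀ y, 0 ≤ |f y| / u y := fun y => div_nonneg (abs_nonneg _) (hu y)
  refine ⟨∑ y, |f y| / u y, Finset.sum_nonneg fun y _ => hnn y, fun x => ?_⟩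
  rw [Pi.smul_apply, smul_eq_mul]
  rcases (hu x).eq_or_lt with hx | hx
  · rw [← hx]
    simpa using hf x hx.symm
  · have hx : 0 < u x := hx
    have hle : |f x| / u x ≤ ∑ y, |f y| / u y :=
      Finset.single_le_sum (f := fun y => |f y| / u y) (fun y _ => hnn y) (Finset.mem_univ x)
    exact (le_abs_self _).trans ((div_le_iff₀ hx).1 hle)

/-- Minimum principle: a function that is superharmonic off `A` and nonnegative on `A`
is nonnegative, for a coherent `P` dominating a map from which `A` is reachable. -/
theorem Coherent.nonneg_of_indicator_mul_le {X : Type*} [Fintype X] [Nonempty X] {A : Set X}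
    {Tl P : (X → ℝ) → (X → ℝ)} (hR : Reach A Tl) (hP : Coherent P) (hle : ∀ f, Tl f ≤ P f)
    {g : X → ℝ} (hg : (Aᶜ : Set X).indicator 1 * P g ≤ g) : 0 ≤ g := by
  obtain ⟨x₀, hx₀⟩ := Finite.exists_min g
  by_contra hneg
  have hc : g x₀ < 0 := by
    by_contra! hc
    exact hneg fun x => hc.trans (hx₀ x)
  have hA : ∀ x ∈ A, 0 ≤ g x := fun x hx => by simpa [hx] using hg x
  have hAc : ∀ x, g x = g x₀ → x ∈ Aᶜ := fun x hx hxA => by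
    have := hA x hxA
    linarith
  set u : X → ℝ := fun x => g x - g x₀ with hu_def
  have hu : 0 ≤ u := fun x => sub_nonneg.2 (hx₀ x)
  have hPu : ∀ x, u x = 0 → P u x ≤ 0 := fun x hx => by
    have hx : g x = g x₀ := sub_eq_zero.1 hx
    have h₁ : P g x ≤ g x := by simpa [hAc x hx] using hg x
    have h₂ := hP.2.1 u (fun _ => g x₀) x
    have h₃ := hP.2.2 (fun _ => g x₀) x
    have h₄ : (u + fun _ => g x₀) = g := by
      ext y
      simp [hu_def]
    rw [h₄, Pi.add_apply] at h₂
    rw [ciInf_const] at h₃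
    linarith
  have key : ∀ n x, u x = 0 → Tl^[n] (A.indicator 1) x ≤ 0 := by
    intro n
    induction n with
    | zero =>
      intro x hx
      have : x ∉ A := hAc x (sub_eq_zero.1 hx)
      simp [this]
    | succ n ih =>
      intro x hx
      obtain ⟨K, hK, hle'⟩ := exists_le_smul_of_nonpos_on_zeros hu ih
      rw [Function.iterate_succ_apply']
      refine ((hle _ x).trans (hP.mono_s19 hle' x)).trans ?_
      rw [hP.1 K hK]
      exact mul_nonpos_of_nonneg_of_nonpos hK (hPu x hx)
  obtain ⟨n, -, hn⟩ := hR x₀ (hAc x₀ rfl)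
  exact (key n x₀ (sub_self _)).not_gt hn

/-- Comparison principle for the hitting-time equation `h = 𝟙 + 𝟙 · P h`. -/
theorem DualRep.le_of_hitting_eq {X : Type*} [Fintype X] [Nonempty X] {A : Set X}
    {Tl P : (X → ℝ) → (X → ℝ)} (hR : Reach A Tl) (hP : P ∈ DualRep Tl) {f g : X → ℝ}
    (hf : f ≤ (Aᶜ : Set X).indicator 1 + (Aᶜ : Set X).indicator 1 * P f)
    (hg : (Aᶜ : Set X).indicator 1 + (Aᶜ : Set X).indicator 1 * P g ≤ g) : f ≤ g := by
  obtain ⟨hlin, hcoh, hdom⟩ := hP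
  refine sub_nonneg.1 (Coherent.nonneg_of_indicator_mul_le hR hcoh hdom ?_)
  rw [hlin.map_sub, mul_sub]
  intro x
  have h₁ := hf x
  have h₂ := hg x
  simp only [Pi.add_apply, Pi.sub_apply] at h₁ h₂ ⊢
  linarith


theorem stmt19 {X : Type*} [Fintype X] [Nonempty X] (A : Set X)
    (hA : A.Nonempty) (hAc : (Aᶜ : Set X).Nonempty)
    (Tl : (X → ℝ) → (X → ℝ)) (hTl : Coherent Tl) (hR : Reach A Tl)
    (m : ℕ) (hm : 1 ≤ m)
    (hfin : (Set.extremePoints ℝ (DualRep Tl)).Finite)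
    (hcard : hfin.toFinset.card = m)
    (T : ℕ → (X → ℝ) → (X → ℝ)) (h : ℕ → X → ℝ)
    (hext : ∀ n : ℕ, 1 ≤ n → T n ∈ Set.extremePoints ℝ (DualRep Tl))
    (hsol : ∀ n : ℕ, 1 ≤ n →
      h n = (Aᶜ : Set X).indicator 1 + (Aᶜ : Set X).indicator 1 * T n (h n))
    (hnext : ∀ n : ℕ, 1 ≤ n → Tl (h n) = T (n + 1) (h n)) :
    ∃ n : ℕ, 1 ≤ n ∧ n ≤ m ∧
      ∃ hstar : X → ℝ, Tendsto h atTop (𝓝 hstar) ∧ ∀ k : ℕ, n ≤ k → h k = hstar := by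
  have hmem : ∀ n, 1 ≤ n → T n ∈ DualRep Tl := fun n hn => (hext n hn).1
  have hind : (0 : X → ℝ) ≤ (Aᶜ : Set X).indicator 1 :=
    Set.indicator_nonneg fun _ _ => zero_le_one
  have hstep : ∀ n, 1 ≤ n → h (n + 1) ≤ h n := fun n hn => by
    refine DualRep.le_of_hitting_eq hR (hmem (n + 1) (by omega)) (hsol (n + 1) (by omega)).le ?_
    rw [← hnext n hn]
    conv_rhs => rw [hsol n hn]
    gcongr
    exact (hmem n hn).2.2 _
  have hanti : ∀ k, 1 ≤ k → ∀ j, k ≤ j → h j ≤ h k := fun k hk j hkj => by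
    induction j, hkj using Nat.le_induction with
    | base => exact le_rfl
    | succ j hkj ih => exact (hstep j (hk.trans hkj)).trans ih
  have hprop : ∀ k, 1 ≤ k → h (k + 1) = h k → h (k + 2) = h (k + 1) := fun k hk heq => by
    have hT : T (k + 2) (h (k + 1)) = T (k + 1) (h (k + 1)) := by
      rw [← hnext (k + 1) (by omega), heq, hnext k hk]
    have h₁ := hsol (k + 1) (by omega)
    rw [← hT] at h₁
    have h₂ := hsol (k + 2) (by omega)
    exact le_antisymm (DualRep.le_of_hitting_eq hR (hmem (k + 2) (by omega)) h₂.le h₁.ge)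
      (DualRep.le_of_hitting_eq hR (hmem (k + 2) (by omega)) h₁.le h₂.ge)
  obtain ⟨k, hk, j, hj, hne, hTkj⟩ :
      ∃ k ∈ Finset.Icc 1 (m + 1), ∃ j ∈ Finset.Icc 1 (m + 1), k ≠ j ∧ T k = T j := by
    refine Finset.exists_ne_map_eq_of_card_lt_of_maps_to (t := hfin.toFinset) ?_ ?_
    · simp [hcard]
    · intro n hn
      simpa using hext n (Finset.mem_Icc.1 hn).1
  rw [Finset.mem_Icc] at hk hj
  wlog hlt : k < j generalizing k j
  · exact this j hj k hk hne.symm hTkj.symm (by omega)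
  have hkj : h k = h j := by
    have h₁ := hsol k hk.1
    rw [hTkj] at h₁
    have h₂ := hsol j hj.1
    exact le_antisymm (DualRep.le_of_hitting_eq hR (hmem j hj.1) h₁.le h₂.ge)
      (DualRep.le_of_hitting_eq hR (hmem j hj.1) h₂.le h₁.ge)
  have hk1 : h (k + 1) = h k :=
    le_antisymm (hstep k hk.1) (hkj.le.trans (hanti (k + 1) (by omega) j hlt))
  have hsucc : ∀ l, k ≤ l → h (l + 1) = h l := fun l hl => by
    induction l, hl using Nat.le_induction with
    | base => exact hk1
    | succ l hl ih => exact hprop l (hk.1.trans hl) ih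
  have hconst : ∀ l, k ≤ l → h l = h k := fun l hl => by
    induction l, hl using Nat.le_induction with
    | base => rfl
    | succ l hl ih => exact (hsucc l hl).trans ih
  exact ⟨k, hk.1, by omega, h k,
    tendsto_atTop_of_eventually_const (i₀ := k) hconst, hconst⟩
end
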